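/- Let E be a centrally orthocomplete pseudo-effect algebra with set of atoms A. Then: (i) A' = [A]' is strongly type-determining and consists of all atom free elements of E; (ii) A'' = [A]'' is strongly type-determining and its nonzero elements are exactly the p ∈ E such that E[0,p] is atomic; (iii) c_{A'∩γ(A')} = (c_{[A]})' and this element is atom free; (iv) A ⊆ [A] ⊆ E[0,c_{[A]}]; (v) for p ∈ E, p is atom free iff [A] ∩ E[0,p] = {0}; (vi) [A ∩ Γ(E)] = [A] ∩ Γ(E). -/

import Mathlib

namespace PEApaper

/-- The bare data of a partial-addition structure: a partial binary operation
(encoded via `Option`) together with constants `0` and `1`. -/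
structure PartialStruct (E : Type) where
  padd : E → E → Option E
  zero : E
  one : E

namespace PartialStruct

variable {E : Type}

/-- `a ≤ b` iff `a + c = b` for some `c`. -/
def le (P : PartialStruct E) (a b : E) : Prop := ∃ c, P.padd a c = some b

/-- `m` is the greatest lower bound (meet `a ∧ b`) of `a` and `b`. -/
def IsMeet (P : PartialStruct E) (a b m : E) : Prop :=
  P.le m a ∧ P.le m b ∧ ∀ x, P.le x a → P.le x b → P.le x m

/-- `j` is the least upper bound (join `a ∨ b`) of `a` and `b`. -/
def IsJoin (P : PartialStruct E) (a b j : E) : Prop :=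
  P.le a j ∧ P.le b j ∧ ∀ x, P.le a x → P.le b x → P.le j x

/-- `s` is the supremum of the set `S`. -/
def IsSup (P : PartialStruct E) (S : Set E) (s : E) : Prop :=
  (∀ x ∈ S, P.le x s) ∧ ∀ u, (∀ x ∈ S, P.le x u) → P.le s u

/-- Left-associated partial sum of a list, continuing from `acc`. -/
def IsSumFrom (P : PartialStruct E) : E → List E → E → Prop
  | acc, [], s => s = acc
  | acc, a :: l, s => ∃ t, P.padd acc a = some t ∧ IsSumFrom P t l s

/-- `s` is the (left-associated) orthosum `e₁ + e₂ + ⋯ + eₙ` of the list. -/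
def IsSumList (P : PartialStruct E) (l : List E) (s : E) : Prop :=
  match l with
  | [] => s = P.zero
  | a :: t => IsSumFrom P a t s

/-- `c` is a central element: there is a PEA-isomorphism
`f : E → E[0,c] × E[0,c∼]` with `f c = (c,0)` such that `f x = (x₁,x₂)`
implies `x = x₁ + x₂`.  The isomorphism onto the product of the two
interval pseudo-effect algebras is spelled out explicitly. -/
def IsCentral (P : PartialStruct E) (c : E) : Prop :=
  ∃ cs, P.padd c cs = some P.one ∧
    ∃ f : E → E × E,
      (∀ x, P.le (f x).1 c ∧ P.le (f x).2 cs) ∧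
      Function.Injective f ∧
      (∀ y : E × E, P.le y.1 c → P.le y.2 cs → ∃ x, f x = y) ∧
      f c = (c, P.zero) ∧
      f P.one = (c, cs) ∧
      (∀ x, P.padd (f x).1 (f x).2 = some x) ∧
      (∀ a b ab, P.padd a b = some ab →
        P.padd (f a).1 (f b).1 = some (f ab).1 ∧
        P.padd (f a).2 (f b).2 = some (f ab).2) ∧
      (∀ a b s t, P.padd (f a).1 (f b).1 = some s → P.le s c →
        P.padd (f a).2 (f b).2 = some t → P.le t cs →
        ∃ ab, P.padd a b = some ab)

/-- The center `Γ(E)`. -/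
def center (P : PartialStruct E) : Set E := {c | P.IsCentral c}

/-- The central interval `Γ(E)[0,c] = Γ(E) ∩ E[0,c]`. -/
def centerIntervalSet (P : PartialStruct E) (c : E) : Set E :=
  {x | P.IsCentral x ∧ P.le x c}

/-- A Γ-orthogonal family: one dominated elementwise by a pairwise
disjoint family of central elements. -/
def GammaOrthogonal (P : PartialStruct E) {I : Type} (e : I → E) : Prop :=
  ∃ c : I → E, (∀ i, P.IsCentral (c i)) ∧
    (∀ i j, i ≠ j → P.IsMeet (c i) (c j) P.zero) ∧
    ∀ i, P.le (e i) (c i)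

/-- Centrally orthocomplete: every Γ-orthogonal family has a supremum. -/
def IsCOPEA (P : PartialStruct E) : Prop :=
  ∀ (I : Type) (e : I → E), P.GammaOrthogonal e → ∃ s, P.IsSup (Set.range e) s

/-- `c` is the central cover of `e`: the smallest central element above `e`. -/
def IsCentralCover (P : PartialStruct E) (c e : E) : Prop :=
  P.IsCentral c ∧ P.le e c ∧ ∀ d, P.IsCentral d → P.le e d → P.le c d

/-- `[Q]`: the set of all suprema of Γ-orthogonal families of elements of `Q`. -/
def bra (P : PartialStruct E) (Q : Set E) : Set E :=
  {s | ∃ (I : Type) (e : I → E), (∀ i, e i ∈ Q) ∧ P.GammaOrthogonal e ∧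
    P.IsSup (Set.range e) s}

/-- `Q^γ = {q ∧ c : q ∈ Q, c ∈ Γ(E)}`. -/
def gammaClosure (P : PartialStruct E) (Q : Set E) : Set E :=
  {m | ∃ q ∈ Q, ∃ c, P.IsCentral c ∧ P.IsMeet q c m}

/-- `Q↓ = ⋃_{q ∈ Q} E[0,q]`. -/
def downSet (P : PartialStruct E) (Q : Set E) : Set E :=
  {e | ∃ q ∈ Q, P.le e q}

/-- `Q' = {e ∈ E : q ∧ e = 0 for all q ∈ Q}`. -/
def commutant (P : PartialStruct E) (Q : Set E) : Set E :=
  {e | ∀ q ∈ Q, P.IsMeet q e P.zero}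

/-- A type-determining (TD) set: `K = [K] = K^γ`. -/
def IsTD (P : PartialStruct E) (K : Set E) : Prop :=
  P.bra K = K ∧ P.gammaClosure K = K

/-- A strongly type-determining (STD) set: `K = [K] = K↓`. -/
def IsSTD (P : PartialStruct E) (K : Set E) : Prop :=
  P.bra K = K ∧ P.downSet K = K

/-- `c` is the type-cover of `K` (w.r.t. the central cover map `γ`):
the unique central element with `γK = Γ(E)[0,c]`. -/
def IsTypeCover (P : PartialStruct E) (γ : E → E) (K : Set E) (c : E) : Prop :=
  P.IsCentral c ∧ γ '' K = P.centerIntervalSet c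

/-- An atom: a nonzero element with no proper nonzero subelement. -/
def IsAtom' (P : PartialStruct E) (a : E) : Prop :=
  a ≠ P.zero ∧ ∀ x, P.le x a → x = P.zero ∨ x = a

end PartialStruct

/-- A PEA-isomorphism between two partial-addition structures: a bijective
morphism whose inverse is a morphism. -/
structure IsPEAIso {A B : Type} (P : PartialStruct A) (Q : PartialStruct B)
    (f : A → B) : Prop where
  bijective : Function.Bijective f
  map_one : f P.one = Q.one
  map_add : ∀ a b ab, P.padd a b = some ab → Q.padd (f a) (f b) = some (f ab)
  rev_add : ∀ a b s, Q.padd (f a) (f b) = some s → ∃ ab, P.padd a b = some ab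

open scoped Classical in
/-- The (coordinatewise) product of a family of partial structures. -/
noncomputable def prodStruct {I : Type} {A : I → Type}
    (Ps : ∀ i, PartialStruct (A i)) : PartialStruct (∀ i, A i) where
  padd a b :=
    if h : ∀ i, ∃ s, (Ps i).padd (a i) (b i) = some s
    then some fun i => Classical.choose (h i)
    else none
  zero := fun i => (Ps i).zero
  one := fun i => (Ps i).one

/-- A pseudo-effect algebra. -/
structure PEA (E : Type) extends PartialStruct E where
  assoc_def : ∀ a b c : E,
    (∃ ab, padd a b = some ab ∧ ∃ x, padd ab c = some x) ↔
    (∃ bc, padd b c = some bc ∧ ∃ y, padd a bc = some y)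
  assoc_eq : ∀ a b c ab bc x y, padd a b = some ab → padd ab c = some x →
    padd b c = some bc → padd a bc = some y → x = y
  exu_right : ∀ a : E, ∃! d, padd a d = some one
  exu_left : ∀ a : E, ∃! e, padd e a = some one
  shift : ∀ a b ab, padd a b = some ab →
    (∃ d, padd d a = some ab) ∧ (∃ e, padd b e = some ab)
  one_add : ∀ a x, padd one a = some x → a = zero
  add_one : ∀ a x, padd a one = some x → a = zero

namespace PEA

variable {E : Type} (P : PEA E)

/-- Shorthand for the underlying partial structure. -/
abbrev ps : PartialStruct E := P.toPartialStruct

theorem one_add_zero : P.padd P.one P.zero = some P.one := by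
  obtain ⟨d, hd, -⟩ := P.exu_right P.one
  have h := P.one_add d P.one hd
  rwa [h] at hd

theorem zero_add_one : P.padd P.zero P.one = some P.one := by
  obtain ⟨e, he, -⟩ := P.exu_left P.one
  have h := P.add_one e P.one he
  rwa [h] at he

theorem padd_zero (a : E) : P.padd a P.zero = some a := by
  obtain ⟨e, he, -⟩ := P.exu_left a
  have h1 : ∃ ab, P.padd e a = some ab ∧ ∃ x, P.padd ab P.zero = some x :=
    ⟨P.one, he, P.one, P.one_add_zero⟩
  obtain ⟨t, ht, y, hy⟩ := (P.assoc_def e a P.zero).mp h1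
  have hxy : P.one = y :=
    P.assoc_eq e a P.zero P.one t P.one y he P.one_add_zero ht hy
  obtain ⟨d, hd, hu⟩ := P.exu_right e
  have hta : t = a := by
    have h2 : t = d := hu t (by rw [← hxy] at hy; exact hy)
    have h3 : a = d := hu a he
    rw [h2, h3]
  rwa [hta] at ht

theorem zero_padd (a : E) : P.padd P.zero a = some a := by
  obtain ⟨d, hd, -⟩ := P.exu_right a
  have h1 : ∃ bc, P.padd a d = some bc ∧ ∃ y, P.padd P.zero bc = some y :=
    ⟨P.one, hd, P.one, P.zero_add_one⟩
  obtain ⟨t, ht, y, hy⟩ := (P.assoc_def P.zero a d).mpr h1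
  have hxy : y = P.one :=
    P.assoc_eq P.zero a d t P.one y P.one ht hy hd P.zero_add_one
  obtain ⟨e, he, hu⟩ := P.exu_left d
  have hta : t = a := by
    have h2 : t = e := hu t (by rw [hxy] at hy; exact hy)
    have h3 : a = e := hu a hd
    rw [h2, h3]
  rwa [hta] at ht

theorem zero_le (a : E) : P.ps.le P.zero a := ⟨a, P.zero_padd a⟩

theorem le_refl (a : E) : P.ps.le a a := ⟨P.zero, P.padd_zero a⟩

open scoped Classical in
/-- The interval pseudo-effect algebra `E[0,p]` as a partial structure on
the subtype `{x // x ≤ p}`; the sum is defined iff it is defined in `E`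
and lies below `p`, and the unit is `p`. -/
noncomputable def intervalStruct (p : E) :
    PartialStruct {x : E // P.ps.le x p} where
  padd a b := (P.padd a.1 b.1).bind fun s =>
    if h : P.ps.le s p then some ⟨s, h⟩ else none
  zero := ⟨P.zero, P.zero_le p⟩
  one := ⟨p, P.le_refl p⟩

end PEA

/-- The order relation of a complete Boolean algebra structure, made explicit. -/
def cbaLe {X : Type} (inst : CompleteBooleanAlgebra X) (a b : X) : Prop :=
  @LE.le X (by letI := inst; exact inferInstance) a b

end PEApaper

namespace PEApaper

namespace PEA

variable {E : Type} (P : PEA E)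

theorem padd_assoc {a b c ab x : E} (h₁ : P.padd a b = some ab) (h₂ : P.padd ab c = some x) :
    ∃ bc, P.padd b c = some bc ∧ P.padd a bc = some x := by
  obtain ⟨bc, hbc, y, hy⟩ := (P.assoc_def a b c).mp ⟨ab, h₁, x, h₂⟩
  have hxy := P.assoc_eq a b c ab bc x y h₁ h₂ hbc hy
  exact ⟨bc, hbc, hxy ▸ hy⟩

theorem padd_assoc' {a b c bc x : E} (h₁ : P.padd b c = some bc) (h₂ : P.padd a bc = some x) :
    ∃ ab, P.padd a b = some ab ∧ P.padd ab c = some x := by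
  obtain ⟨ab, hab, y, hy⟩ := (P.assoc_def a b c).mpr ⟨bc, h₁, x, h₂⟩
  have hxy := P.assoc_eq a b c ab bc y x hab hy h₁ h₂
  exact ⟨ab, hab, hxy ▸ hy⟩

theorem padd_left_cancel {a b c s : E} (h₁ : P.padd a b = some s) (h₂ : P.padd a c = some s) :
    b = c := by
  obtain ⟨e, he, -⟩ := P.exu_left s
  obtain ⟨u, hu, hub⟩ := P.padd_assoc' h₁ he
  obtain ⟨v, hv, hvc⟩ := P.padd_assoc' h₂ he
  have huv : u = v := Option.some.inj (hu.symm.trans hv)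
  subst huv
  exact (P.exu_right u).unique hub hvc

theorem eq_zero_of_padd {a b : E} (h : P.padd a b = some P.zero) : a = P.zero := by
  obtain ⟨bc, hbc, -⟩ := P.padd_assoc h P.zero_add_one
  rw [P.add_one b bc hbc, P.padd_zero] at h
  exact Option.some.inj h

theorem eq_zero_of_le_zero {a : E} (h : P.ps.le a P.zero) : a = P.zero :=
  P.eq_zero_of_padd h.choose_spec

theorem eq_zero_of_padd_le {a y s : E} (h : P.padd a y = some s) (hs : P.ps.le s a) :
    y = P.zero := by
  obtain ⟨z, hz⟩ := hs
  obtain ⟨t, ht, hat⟩ := P.padd_assoc h hz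
  rw [P.padd_left_cancel hat (P.padd_zero a)] at ht
  exact P.eq_zero_of_padd ht

theorem le_trans {a b c : E} (h₁ : P.ps.le a b) (h₂ : P.ps.le b c) : P.ps.le a c := by
  obtain ⟨u, hu⟩ := h₁
  obtain ⟨v, hv⟩ := h₂
  obtain ⟨w, -, hw⟩ := P.padd_assoc hu hv
  exact ⟨w, hw⟩

theorem le_antisymm {a b : E} (h₁ : P.ps.le a b) (h₂ : P.ps.le b a) : a = b := by
  obtain ⟨u, hu⟩ := h₁
  rw [P.eq_zero_of_padd_le hu h₂, P.padd_zero] at hu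
  exact Option.some.inj hu

theorem le_one (a : E) : P.ps.le a P.one := (P.exu_right a).exists

theorem le_padd_right {a b s : E} (h : P.padd a b = some s) : P.ps.le b s :=
  (P.shift a b s h).2

theorem isMeet_zero_iff {a b : E} :
    P.ps.IsMeet a b P.zero ↔ ∀ x, P.ps.le x a → P.ps.le x b → x = P.zero :=
  ⟨fun h x ha hb => P.eq_zero_of_le_zero (h.2.2 x ha hb), fun h =>
    ⟨P.zero_le a, P.zero_le b, fun x ha hb => h x ha hb ▸ P.le_refl x⟩⟩

/-- The decomposition of `E` along a central element `c` with complement `cs`, together with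
the values of the decomposition map on the two factors. -/
structure CentralSplit (c cs : E) (f : E → E × E) : Prop where
  compl : P.padd c cs = some P.one
  compl' : P.padd cs c = some P.one
  fst_le : ∀ x, P.ps.le (f x).1 c
  snd_le : ∀ x, P.ps.le (f x).2 cs
  inj : Function.Injective f
  surj : ∀ y : E × E, P.ps.le y.1 c → P.ps.le y.2 cs → ∃ x, f x = y
  map_one : f P.one = (c, cs)
  of_le : ∀ x, P.ps.le x c → f x = (x, P.zero)
  of_le_compl : ∀ x, P.ps.le x cs → f x = (P.zero, x)
  padd_parts : ∀ x, P.padd (f x).1 (f x).2 = some x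
  padd_fst : ∀ a b ab, P.padd a b = some ab → P.padd (f a).1 (f b).1 = some (f ab).1
  padd_snd : ∀ a b ab, P.padd a b = some ab → P.padd (f a).2 (f b).2 = some (f ab).2
  exists_padd : ∀ a b s t, P.padd (f a).1 (f b).1 = some s → P.ps.le s c →
    P.padd (f a).2 (f b).2 = some t → P.ps.le t cs → ∃ ab, P.padd a b = some ab

variable {P}

theorem exists_centralSplit {c cs : E} (hc : P.ps.IsCentral c) (hcs : P.padd c cs = some P.one) :
    ∃ f, P.CentralSplit c cs f := by
  obtain ⟨cs', hcs', f, hle, hinj, hsurj, hfc, hf1, hparts, hadd, hrev⟩ := hc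
  have hcc : cs' = cs := (P.exu_right c).unique hcs' hcs
  subst hcc
  have hof : ∀ x, P.ps.le x c → f x = (x, P.zero) := by
    rintro x ⟨z, hz⟩
    have h2 := (hadd x z c hz).2
    rw [hfc] at h2
    have h0 := P.eq_zero_of_padd h2
    have hx := hparts x
    change P.padd _ _ = _ at hx
    rw [h0, P.padd_zero] at hx
    exact Prod.ext (Option.some.inj hx) h0
  have hcs0 : (f cs').1 = P.zero := by
    have h1 := (hadd c cs' _ hcs).1
    rw [hfc] at h1
    exact P.eq_zero_of_padd_le h1 (hle _).1
  have hof' : ∀ x, P.ps.le x cs' → f x = (P.zero, x) := by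
    rintro x ⟨z, hz⟩
    have h1 := (hadd x z cs' hz).1
    rw [hcs0] at h1
    have h0 := P.eq_zero_of_padd h1
    have hx := hparts x
    change P.padd _ _ = _ at hx
    rw [h0, P.zero_padd] at hx
    exact Prod.ext h0 (Option.some.inj hx)
  refine ⟨f, hcs, ?_, fun x => (hle x).1, fun x => (hle x).2, hinj, hsurj, hf1, hof, hof',
    hparts, fun a b ab h => (hadd a b ab h).1, fun a b ab h => (hadd a b ab h).2, hrev⟩
  have hs := hof' cs' (P.le_refl _)
  obtain ⟨t, ht⟩ := hrev cs' c c cs'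
    (by rw [hs, hfc]; exact P.zero_padd c) (P.le_refl _)
    (by rw [hs, hfc]; exact P.padd_zero cs') (P.le_refl _)
  have ht1 : t = P.one := by
    apply hinj
    have h1 := (hadd cs' c t ht).1
    have h2 := (hadd cs' c t ht).2
    rw [hs, hfc] at h1 h2
    have e1 : some c = some (f t).1 := (P.zero_padd c).symm.trans h1
    have e2 : some cs' = some (f t).2 := (P.padd_zero cs').symm.trans h2
    rw [hf1]
    exact Prod.ext (Option.some.inj e1).symm (Option.some.inj e2).symm
  rw [ht, ht1]

namespace CentralSplit

variable {c cs : E} {f : E → E × E} (h : P.CentralSplit c cs f)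
include h

theorem fst_mono {x y : E} (hxy : P.ps.le x y) : P.ps.le (f x).1 (f y).1 := by
  obtain ⟨z, hz⟩ := hxy
  exact ⟨_, h.padd_fst x z y hz⟩

theorem snd_mono {x y : E} (hxy : P.ps.le x y) : P.ps.le (f x).2 (f y).2 := by
  obtain ⟨z, hz⟩ := hxy
  exact ⟨_, h.padd_snd x z y hz⟩

theorem padd_parts' (x : E) : P.padd (f x).2 (f x).1 = some x := by
  have h1 := h.of_le _ (h.fst_le x)
  have h2 := h.of_le_compl _ (h.snd_le x)
  obtain ⟨t, ht⟩ := h.exists_padd (f x).2 (f x).1 (f x).1 (f x).2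
    (by rw [h1, h2]; exact P.zero_padd _) (h.fst_le x)
    (by rw [h1, h2]; exact P.padd_zero _) (h.snd_le x)
  have e1 := h.padd_fst _ _ _ ht
  have e2 := h.padd_snd _ _ _ ht
  rw [h1, h2] at e1 e2
  have htx : t = x := h.inj (Prod.ext (Option.some.inj (e1.symm.trans (P.zero_padd _)))
    (Option.some.inj (e2.symm.trans (P.padd_zero _))))
  rw [ht, htx]

theorem isCentral_compl : P.ps.IsCentral cs := by
  refine ⟨c, h.compl', fun x => ((f x).2, (f x).1), fun x => ⟨h.snd_le x, h.fst_le x⟩, ?_, ?_,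
    ?_, ?_, h.padd_parts', fun a b ab hab => ⟨h.padd_snd a b ab hab, h.padd_fst a b ab hab⟩,
    fun a b s t hs hsc ht htc => h.exists_padd a b t s ht htc hs hsc⟩
  · intro x y hxy
    exact h.inj (Prod.ext (congrArg Prod.snd hxy) (congrArg Prod.fst hxy))
  · intro y h1 h2
    obtain ⟨x, hx⟩ := h.surj (y.2, y.1) h2 h1
    exact ⟨x, by simp [hx]⟩
  · simp [h.of_le_compl cs (P.le_refl cs)]
  · simp [h.map_one]

end CentralSplit

theorem isCentral_compl {c cs : E} (hc : P.ps.IsCentral c) (hcs : P.padd c cs = some P.one) :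
    P.ps.IsCentral cs :=
  (exists_centralSplit hc hcs).choose_spec.isCentral_compl

theorem eq_zero_of_le_of_le_compl {c cs x : E} (hc : P.ps.IsCentral c)
    (hcs : P.padd c cs = some P.one) (h₁ : P.ps.le x c) (h₂ : P.ps.le x cs) : x = P.zero := by
  obtain ⟨f, h⟩ := exists_centralSplit hc hcs
  have := (h.of_le x h₁).symm.trans (h.of_le_compl x h₂)
  exact congrArg Prod.fst this

theorem le_compl_of_disjoint {c cs x : E} (hc : P.ps.IsCentral c)
    (hcs : P.padd c cs = some P.one) (hx : ∀ y, P.ps.le y x → P.ps.le y c → y = P.zero) :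
    P.ps.le x cs := by
  obtain ⟨f, h⟩ := exists_centralSplit hc hcs
  have h0 := hx _ ⟨_, h.padd_parts x⟩ (h.fst_le x)
  have hp := h.padd_parts x
  rw [h0, P.zero_padd] at hp
  rw [← Option.some.inj hp]
  exact h.snd_le x

theorem eq_zero_of_central_padd {a y s : E} (ha : P.ps.IsCentral a)
    (hs : P.padd a y = some s) (hy : P.ps.le y a) : y = P.zero := by
  obtain ⟨cs, hcs⟩ := (P.exu_right a).exists
  obtain ⟨f, h⟩ := exists_centralSplit ha hcs
  have h1 := h.padd_fst a y s hs
  rw [h.of_le a (P.le_refl a), h.of_le y hy] at h1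
  exact P.eq_zero_of_padd_le h1 (h.fst_le s)

/-- The meet of the supremum of a Γ-orthogonal family with one of the separating central
elements is the corresponding member of the family. -/
theorem le_of_le_sup_of_le {I : Type} {e c : I → E} (hc : ∀ i, P.ps.IsCentral (c i))
    (hdisj : ∀ i j, i ≠ j → P.ps.IsMeet (c i) (c j) P.zero) (hec : ∀ i, P.ps.le (e i) (c i))
    {s : E} (hs : P.ps.IsSup (Set.range e) s) {i : I} {y : E} (hys : P.ps.le y s)
    (hyc : P.ps.le y (c i)) : P.ps.le y (e i) := by
  obtain ⟨cs, hcs⟩ := (P.exu_right (c i)).exists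
  obtain ⟨f, h⟩ := exists_centralSplit (hc i) hcs
  obtain ⟨u, hu⟩ := h.surj (e i, (f s).2) (hec i) (h.snd_le s)
  have hpu := h.padd_parts u
  rw [hu] at hpu
  have hsu : P.ps.le s u := by
    refine hs.2 u ?_
    rintro _ ⟨j, rfl⟩
    by_cases hij : j = i
    · subst hij
      exact ⟨_, hpu⟩
    · have hj : P.ps.le (e j) cs := le_compl_of_disjoint (hc i) hcs fun y hy hyi =>
        P.isMeet_zero_iff.mp (hdisj j i hij) y (P.le_trans hy (hec j)) hyi
      have hm := h.snd_mono (hs.1 _ ⟨j, rfl⟩)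
      rw [h.of_le_compl _ hj] at hm
      exact P.le_trans hm (P.le_padd_right hpu)
  have h1 := h.fst_mono (P.le_trans hys hsu)
  rwa [hu, h.of_le y hyc] at h1

section CentralCover

variable {γ : E → E} (hγ : ∀ e, P.ps.IsCentralCover (γ e) e)
include hγ

theorem isCentral_one : P.ps.IsCentral P.one :=
  P.le_antisymm (hγ P.one).2.1 (P.le_one _) ▸ (hγ P.one).1

/-- If every element of `S` is separated from `x` by a central element, then the central
covers of `x` and of the supremum of `S` are disjoint. -/
theorem centralCover_sup_disjoint {S : Set E} {s x : E} (hs : P.ps.IsSup S s)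
    (h : ∀ e ∈ S, ∃ c, P.ps.IsCentral c ∧ P.ps.le e c ∧
      ∀ y, P.ps.le y x → P.ps.le y c → y = P.zero)
    {z : E} (hzs : P.ps.le z (γ s)) (hzx : P.ps.le z (γ x)) : z = P.zero := by
  obtain ⟨t, ht⟩ := (P.exu_right (γ x)).exists
  have htc := isCentral_compl (hγ x).1 ht
  have hst : P.ps.le s t := by
    refine hs.2 t fun e he => ?_
    obtain ⟨c, hc, hec, hd⟩ := h e he
    obtain ⟨cs, hcs⟩ := (P.exu_right c).exists
    have hx : P.ps.le (γ x) cs :=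
      (hγ x).2.2 cs (isCentral_compl hc hcs) (le_compl_of_disjoint hc hcs hd)
    exact P.le_trans hec (le_compl_of_disjoint (hγ x).1 ht fun y hy hyx =>
      eq_zero_of_le_of_le_compl hc hcs hy (P.le_trans hyx hx))
  exact eq_zero_of_le_of_le_compl (hγ x).1 ht hzx (P.le_trans hzs ((hγ s).2.2 t htc hst))

/-- An element below the supremum of a Γ-orthogonal family that is disjoint from every member
of the family is zero. -/
theorem eq_zero_of_le_sup {I : Type} {e : I → E} (he : P.ps.GammaOrthogonal e) {s : E}
    (hs : P.ps.IsSup (Set.range e) s) {x : E} (hxs : P.ps.le x s)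
    (hx : ∀ i y, P.ps.le y x → P.ps.le y (e i) → y = P.zero) : x = P.zero := by
  obtain ⟨c, hc, hdisj, hec⟩ := he
  refine centralCover_sup_disjoint hγ (x := x) hs ?_ (P.le_trans hxs (hγ s).2.1) (hγ x).2.1
  rintro _ ⟨i, rfl⟩
  exact ⟨c i, hc i, hec i, fun y hyx hyc =>
    hx i y hyx (le_of_le_sup_of_le hc hdisj hec hs (P.le_trans hyx hxs) hyc)⟩

theorem isCentral_sup {S : Set E} {s : E} (hS : ∀ a ∈ S, P.ps.IsCentral a)
    (hs : P.ps.IsSup S s) : P.ps.IsCentral s := by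
  obtain ⟨r, hr⟩ := (hγ s).2.1
  have hr0 : r = P.zero := by
    refine centralCover_sup_disjoint hγ (x := r) hs ?_ (P.le_padd_right hr) (hγ r).2.1
    refine fun a ha => ⟨a, hS a ha, P.le_refl a, fun y hyr hya => ?_⟩
    obtain ⟨v, hv⟩ := hs.1 a ha
    obtain ⟨b, hb⟩ := (P.shift a v s hv).1
    obtain ⟨z, hz⟩ := hyr
    obtain ⟨w, hw, -⟩ := P.padd_assoc' hz hr
    obtain ⟨t, ht, -⟩ := P.padd_assoc hb hw
    exact eq_zero_of_central_padd (hS a ha) ht hya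
  change P.padd s r = _ at hr
  rw [hr0, P.padd_zero] at hr
  exact Option.some.inj hr ▸ (hγ s).1

theorem subset_bra (Q : Set E) : Q ⊆ P.ps.bra Q := by
  intro q hq
  refine ⟨Unit, fun _ => q, fun _ => hq, ⟨fun _ => P.one, fun _ => isCentral_one hγ,
    fun i j hij => (hij rfl).elim, fun _ => P.le_one q⟩, ?_, ?_⟩
  · rintro _ ⟨_, rfl⟩
    exact P.le_refl q
  · exact fun u hu => hu q ⟨(), rfl⟩

theorem commutant_bra (Q : Set E) : P.ps.commutant (P.ps.bra Q) = P.ps.commutant Q := by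
  refine Set.Subset.antisymm (fun _ he q hq => he q (subset_bra hγ Q hq)) ?_
  rintro x hx s ⟨I, e, he, hort, hs⟩
  refine P.isMeet_zero_iff.mpr fun y hys hyx => eq_zero_of_le_sup hγ hort hs hys ?_
  exact fun i z hzy hze => P.isMeet_zero_iff.mp (hx _ (he i)) z hze (P.le_trans hzy hyx)

theorem isSTD_commutant (Q : Set E) : P.ps.IsSTD (P.ps.commutant Q) := by
  refine ⟨Set.Subset.antisymm ?_ (subset_bra hγ _), Set.Subset.antisymm ?_ ?_⟩
  · rintro s ⟨I, e, he, hort, hs⟩ q hq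
    refine P.isMeet_zero_iff.mpr fun x hxq hxs => eq_zero_of_le_sup hγ hort hs hxs ?_
    exact fun i y hyx hye => P.isMeet_zero_iff.mp (he i q hq) y (P.le_trans hyx hxq) hye
  · rintro x ⟨e, he, hxe⟩ q hq
    exact P.isMeet_zero_iff.mpr fun y hyq hyx =>
      P.isMeet_zero_iff.mp (he q hq) y hyq (P.le_trans hyx hxe)
  · exact fun x hx => ⟨x, hx, P.le_refl x⟩

end CentralCover

end PEA

end PEApaper

open PEApaper PEApaper.PartialStruct in
/-- Theorem 6.3: in a COPEA with set of atoms `A`: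
(i) `A' = [A]'` is STD and consists of the atom free elements;
(ii) `A'' = [A]''` is STD and its nonzero part consists of the `p` with
`E[0,p]` atomic;
(iii) `c_{A'∩γ(A')} = (c_{[A]})'`, which is atom free;
(iv) `A ⊆ [A] ⊆ E[0,c_{[A]}]`;
(v) `p` is atom free iff `[A] ∩ E[0,p] = {0}`;
(vi) `[A ∩ Γ(E)] = [A] ∩ Γ(E)`. -/
theorem stmt18 {E : Type} (P : PEA E) (hco : P.ps.IsCOPEA)
    (γ : E → E) (hγ : ∀ e, P.ps.IsCentralCover (γ e) e)
    (A : Set E) (hA : A = {a | P.ps.IsAtom' a})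
    (cA : E) (hcA : P.ps.IsTypeCover γ (P.ps.bra A) cA)
    (cA' : E) (hcA' : P.ps.padd cA cA' = some P.ps.one)
    (d : E) (hd : P.ps.IsCentral d ∧
      P.ps.commutant A ∩ (γ '' P.ps.commutant A) = P.ps.centerIntervalSet d) :
    (P.ps.commutant A = P.ps.commutant (P.ps.bra A) ∧
      P.ps.IsSTD (P.ps.commutant A) ∧
      P.ps.commutant A = {p | ∀ a ∈ A, ¬ P.ps.le a p}) ∧
    (P.ps.commutant (P.ps.commutant A) =
        P.ps.commutant (P.ps.commutant (P.ps.bra A)) ∧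
      P.ps.IsSTD (P.ps.commutant (P.ps.commutant A)) ∧
      ∀ p, p ≠ P.ps.zero →
        (p ∈ P.ps.commutant (P.ps.commutant A) ↔
          ∀ e, e ≠ P.ps.zero → P.ps.le e p → ∃ a ∈ A, P.ps.le a e)) ∧
    (d = cA' ∧ ∀ a ∈ A, ¬ P.ps.le a d) ∧
    (A ⊆ P.ps.bra A ∧ ∀ x ∈ P.ps.bra A, P.ps.le x cA) ∧
    (∀ p, (∀ a ∈ A, ¬ P.ps.le a p) ↔
      P.ps.bra A ∩ {x | P.ps.le x p} = {P.ps.zero}) ∧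
    P.ps.bra (A ∩ P.ps.center) = P.ps.bra A ∩ P.ps.center := by
  subst hA
  have hfree : P.ps.commutant {a | P.ps.IsAtom' a} =
      {p | ∀ a ∈ {a | P.ps.IsAtom' a}, ¬ P.ps.le a p} := by
    refine Set.Subset.antisymm (fun e he a ha hae => ?_) fun e he a ha => ?_
    · exact ha.1 (P.isMeet_zero_iff.mp (he a ha) a (P.le_refl a) hae)
    · refine P.isMeet_zero_iff.mpr fun x hxa hxe => (ha.2 x hxa).resolve_right ?_
      rintro rfl
      exact he x ha hxe
  have hcov : ∀ x ∈ P.ps.bra {a | P.ps.IsAtom' a}, P.ps.le x cA := fun x hx =>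
    P.le_trans (hγ x).2.1 (hcA.2 ▸ Set.mem_image_of_mem γ hx :
      γ x ∈ P.ps.centerIntervalSet cA).2
  have hsub := PEA.subset_bra hγ {a | P.ps.IsAtom' a}
  have hd_mem : d ∈ P.ps.commutant {a | P.ps.IsAtom' a} :=
    (hd.2.symm ▸ (⟨hd.1, P.le_refl d⟩ : d ∈ P.ps.centerIntervalSet d) :
      d ∈ P.ps.commutant {a | P.ps.IsAtom' a} ∩ γ '' P.ps.commutant {a | P.ps.IsAtom' a}).1
  have hdc : d = cA' := by
    have hcen := PEA.isCentral_compl hcA.1 hcA'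
    apply P.le_antisymm
    · obtain ⟨ds, hds⟩ := (P.exu_right d).exists
      obtain ⟨q, ⟨I, e, he, -, hq⟩, hqc⟩ : cA ∈ γ '' P.ps.bra {a | P.ps.IsAtom' a} :=
        hcA.2.symm ▸ (⟨hcA.1, P.le_refl cA⟩ : cA ∈ P.ps.centerIntervalSet cA)
      have hqd : P.ps.le q ds := by
        refine hq.2 ds ?_
        rintro _ ⟨i, rfl⟩
        exact PEA.le_compl_of_disjoint hd.1 hds (P.isMeet_zero_iff.mp (hd_mem _ (he i)))
      have hcd : P.ps.le cA ds := hqc ▸ (hγ q).2.2 ds (PEA.isCentral_compl hd.1 hds) hqd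
      exact PEA.le_compl_of_disjoint hcA.1 hcA' fun y hyd hyc =>
        PEA.eq_zero_of_le_of_le_compl hd.1 hds hyd (P.le_trans hyc hcd)
    · have hmem : cA' ∈ P.ps.commutant {a | P.ps.IsAtom' a} := by
        rw [hfree]
        exact fun a ha hac =>
          ha.1 (PEA.eq_zero_of_le_of_le_compl hcA.1 hcA' (hcov a (hsub ha)) hac)
      have hγc : γ cA' = cA' :=
        P.le_antisymm ((hγ cA').2.2 cA' hcen (P.le_refl _)) (hγ cA').2.1
      exact (hd.2 ▸ ⟨hmem, cA', hmem, hγc⟩ : cA' ∈ P.ps.centerIntervalSet d).2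
  refine ⟨⟨(PEA.commutant_bra hγ _).symm, PEA.isSTD_commutant hγ _, hfree⟩,
    ⟨by rw [PEA.commutant_bra hγ], PEA.isSTD_commutant hγ _, fun p _ => ⟨?_, ?_⟩⟩,
    ⟨hdc, hfree.le hd_mem⟩, ⟨hsub, hcov⟩, fun p => ⟨?_, ?_⟩, Set.Subset.antisymm ?_ ?_⟩
  · intro hp e he hep
    by_contra! hno
    exact he (P.isMeet_zero_iff.mp (hp e (hfree ▸ hno)) e (P.le_refl e) hep)
  · intro hp q hq
    refine P.isMeet_zero_iff.mpr fun x hxq hxp => by_contra fun hx => ?_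
    obtain ⟨a, ha, hax⟩ := hp x hx hxp
    rw [hfree] at hq
    exact hq a ha (P.le_trans hax hxq)
  · intro hp
    refine Set.Subset.antisymm ?_ ?_
    · rintro x ⟨⟨I, e, he, -, hx⟩, hxp⟩
      refine P.eq_zero_of_le_zero (hx.2 _ ?_)
      rintro _ ⟨i, rfl⟩
      exact (hp _ (he i) (P.le_trans (hx.1 _ ⟨i, rfl⟩) hxp)).elim
    · rintro _ rfl
      refine ⟨⟨Empty, Empty.elim, fun i => i.elim, ⟨Empty.elim, fun i => i.elim,
        fun i => i.elim, fun i => i.elim⟩, ?_, fun u _ => P.zero_le u⟩, P.zero_le p⟩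
      rintro _ ⟨i, -⟩
      exact i.elim
  · intro hp a ha hap
    exact ha.1 (hp ▸ ⟨hsub ha, hap⟩ : a ∈ ({P.ps.zero} : Set E))
  · rintro s ⟨I, e, he, hort, hs⟩
    refine ⟨⟨I, e, fun i => (he i).1, hort, hs⟩, PEA.isCentral_sup hγ ?_ hs⟩
    rintro _ ⟨i, rfl⟩
    exact (he i).2
  · rintro s ⟨⟨I, e, he, ⟨c, hc, hdisj, hec⟩, hs⟩, hsc⟩
    refine ⟨I, e, fun i => ⟨he i, ?_⟩, ⟨c, hc, hdisj, hec⟩, hs⟩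
    have hle : P.ps.le (γ (e i)) (e i) := PEA.le_of_le_sup_of_le hc hdisj hec hs
      ((hγ (e i)).2.2 s hsc (hs.1 _ ⟨i, rfl⟩)) ((hγ (e i)).2.2 (c i) (hc i) (hec i))
    exact P.le_antisymm hle (hγ (e i)).2.1 ▸ (hγ (e i)).1
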